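/- Let M ≥ 1 and for each j ∈ Fin M let a_j : ℕ → ℝ and D_j : ℕ → ℝ satisfy D_j(n) > 0 and a_j(n+1) = a_j(n) + D_j(n) for all n. Fix j₀ ∈ Fin M and issued-grant counts N : Fin M → ℕ, and let t = a_{j₀}(N(j₀)) be the start time of the next grant to be issued on multipath j₀. Then the number of pairs (j, n) with n < N(j) and t ∈ [a_j(n), a_j(n) + D_j(n)) is at most M − 1; that is, at the start time of a new grant for multipath j₀, at most M − 1 already issued grants are active. -/

import Mathlib

/-- A point lies in at most one of the consecutive intervals `[f n, f (n + 1))` of a monotone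
sequence. -/
theorem Monotone.eq_of_mem_Ico_succ {α : Type*} [LinearOrder α] {f : ℕ → α} (hf : Monotone f)
    {x : α} {m n : ℕ} (hm : x ∈ Set.Ico (f m) (f (m + 1))) (hn : x ∈ Set.Ico (f n) (f (n + 1))) :
    m = n :=
  le_antisymm (Nat.lt_succ_iff.1 (hf.reflect_lt (hm.1.trans_lt hn.2)))
    (Nat.lt_succ_iff.1 (hf.reflect_lt (hn.1.trans_lt hm.2)))

/-- At the start time of a new grant on multipath j₀, at most M − 1 of the already
issued grants are active. -/
theorem at_most_M_sub_one_active_at_new_grant_start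
    (M : ℕ) (hM : 1 ≤ M)
    (a D : Fin M → ℕ → ℝ)
    (hD : ∀ j n, 0 < D j n)
    (hrec : ∀ j n, a j (n + 1) = a j n + D j n)
    (j₀ : Fin M) (N : Fin M → ℕ) :
    {p : Fin M × ℕ | p.2 < N p.1 ∧
      a j₀ (N j₀) ∈ Set.Ico (a p.1 p.2) (a p.1 p.2 + D p.1 p.2)}.Finite ∧
    {p : Fin M × ℕ | p.2 < N p.1 ∧
      a j₀ (N j₀) ∈ Set.Ico (a p.1 p.2) (a p.1 p.2 + D p.1 p.2)}.ncard ≤ M - 1 := by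
  have hmono (j) : Monotone (a j) :=
    monotone_nat_of_le_succ fun n => by linarith [hD j n, hrec j n]
  simp only [← hrec]
  set S := {p : Fin M × ℕ | p.2 < N p.1 ∧
    a j₀ (N j₀) ∈ Set.Ico (a p.1 p.2) (a p.1 (p.2 + 1))}
  have hinj : Set.InjOn Prod.fst S := by
    rintro ⟨j, m⟩ ⟨-, hm⟩ ⟨_, n⟩ ⟨-, hn⟩ rfl
    exact Prod.ext rfl ((hmono j).eq_of_mem_Ico_succ hm hn)
  have hmaps : Set.MapsTo Prod.fst S ({j₀}ᶜ : Set (Fin M)) := by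
    rintro ⟨_, n⟩ ⟨hlt, hn⟩ rfl
    exact (hmono _ (Nat.succ_le_of_lt hlt)).not_gt hn.2
  refine ⟨Set.Finite.of_injOn hmaps hinj (Set.toFinite _), ?_⟩
  calc S.ncard ≤ ({j₀}ᶜ : Set (Fin M)).ncard := Set.ncard_le_ncard_of_injOn _ hmaps hinj
    _ = M - 1 := by rw [Set.ncard_compl, Set.ncard_singleton, Nat.card_fin]
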